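/- arXiv:0801.2793 — 3 statements merged into one kernel-verified Lean document; each statement's English description precedes it below -/
import Mathlib

section
/- For every dimension d ≥ 1 there is a constant C (depending only on d) such that: for every finite set X ⊂ ℝ^d with |X| = n ≥ 2 there exists a coloring χ : X → {−1,+1} such that for every axis-parallel box R ∈ R_d, |Σ_{x ∈ X∩R} χ(x)| ≤ C·(log n)^{2d}. -/
open scoped Classical BigOperators

open Finset in
/-- A homogeneous linear system with fewer equations (one for each set of `𝓖`) than unknowns has a
nonzero solution. -/
theorem exists_ne_zero_forall_sum_eq_zero {α : Type*} (𝓖 : Finset (Finset α)) (A : Finset α)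
    (h : #𝓖 < #A) :
    ∃ y : α → ℝ, (∀ x ∉ A, y x = 0) ∧ (∃ a ∈ A, y a ≠ 0) ∧ ∀ F ∈ 𝓖, ∑ x ∈ F, y x = 0 := by
  let ext0 : (A → ℝ) →ₗ[ℝ] (α → ℝ) := Function.ExtendByZero.linearMap ℝ Subtype.val
  let L : (A → ℝ) →ₗ[ℝ] (𝓖 → ℝ) :=
    LinearMap.pi fun F => (∑ x ∈ F.1, LinearMap.proj x) ∘ₗ ext0
  have hL : LinearMap.ker L ≠ ⊥ := LinearMap.ker_ne_bot_of_finrank_lt (by simpa using h)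
  obtain ⟨z, hz, hz0⟩ := (Submodule.ne_bot_iff _).1 hL
  obtain ⟨a, ha⟩ := Function.ne_iff.1 hz0
  refine ⟨ext0 z, fun x hx => ?_, ⟨a, a.2, ?_⟩, fun F hF => ?_⟩
  · exact Function.extend_apply' _ _ _ fun ⟨b, hb⟩ => hx (hb ▸ b.2)
  · have : ext0 z a = z a := Subtype.val_injective.extend_apply z 0 a
    rw [this]
    exact ha
  · simpa [L] using congrFun (LinearMap.mem_ker.1 hz) ⟨F, hF⟩

/-- A nonconstant line through a point of the cube `[-1, 1]^A` meets the boundary of the cube. -/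
theorem exists_add_mul_abs_eq_one {α : Type*} (A : Finset α) (χ y : α → ℝ)
    (hχ : ∀ x ∈ A, |χ x| ≤ 1) (hy : ∃ a ∈ A, y a ≠ 0) :
    ∃ s : ℝ, (∀ x ∈ A, |χ x + s * y x| ≤ 1) ∧ ∃ a ∈ A, |χ a + s * y a| = 1 := by
  obtain ⟨a, ha, hya⟩ := hy
  have hA : A.Nonempty := ⟨a, ha⟩
  let g : ℝ → ℝ := fun s => A.sup' hA fun x => |χ x + s * y x|
  have hg : Continuous g := Continuous.finset_sup'_apply hA fun x _ => by fun_prop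
  have h0 : g 0 ≤ 1 := Finset.sup'_le _ _ fun x hx => by simpa using hχ x hx
  have h1 : 1 ≤ g (2 / y a) := by
    refine le_trans ?_ (Finset.le_sup' (fun x => |χ x + 2 / y a * y x|) ha)
    rw [div_mul_cancel₀ _ hya]
    have := (abs_le.1 (hχ a ha)).1
    exact le_trans (by linarith) (le_abs_self _)
  obtain ⟨s, hs⟩ := mem_range_of_exists_le_of_exists_ge hg ⟨0, h0⟩ ⟨_, h1⟩
  refine ⟨s, fun x hx => hs ▸ Finset.le_sup' (fun x => |χ x + s * y x|) hx, ?_⟩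
  obtain ⟨b, hb, hbe⟩ := Finset.exists_mem_eq_sup' hA fun x => |χ x + s * y x|
  exact ⟨b, hb, hbe.symm.trans hs⟩

open Finset in
/-- In a set system of maximum degree at most `t` on a nonempty set `A`, fewer than `#A` sets have
more than `t` elements in `A`. -/
theorem card_filter_lt_card_inter_lt {α : Type*} (𝓕 : Finset (Finset α)) (t : ℕ) (A : Finset α)
    (hA : A.Nonempty) (hdeg : ∀ x ∈ A, #{F ∈ 𝓕 | x ∈ F} ≤ t) :
    #{F ∈ 𝓕 | t < #(F ∩ A)} < #A := by
  have hle : #{F ∈ 𝓕 | t < #(F ∩ A)} * (t + 1) ≤ #A * t := by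
    refine Finset.card_mul_le_card_mul' (fun x F => x ∈ F) (fun F hF => ?_) (fun x hx => ?_)
    · rw [mem_filter] at hF
      refine hF.2.trans_le (card_le_card fun x hx => ?_)
      simpa [bipartiteBelow, and_comm] using hx
    · exact (card_le_card (filter_subset_filter _ (filter_subset _ _))).trans (hdeg x hx)
  have := hA.card_pos
  by_contra! hcon
  nlinarith [Nat.mul_le_mul_right (t + 1) hcon]

open Finset in
/-- The **Beck–Fiala theorem**, in the form of a rounding statement: if each element of `A` lies in
at most `t` sets of `𝓕`, then values in `[-1, 1]` on `A` can be rounded to `±1` so that the sum over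
each set of `𝓕` changes by at most `2 * t`. -/
theorem exists_rounding_of_degree_le {α : Type*} (𝓕 : Finset (Finset α)) (t : ℕ) (A : Finset α)
    (hdeg : ∀ x ∈ A, #{F ∈ 𝓕 | x ∈ F} ≤ t) (χ : α → ℝ) (hχ : ∀ x ∈ A, |χ x| ≤ 1) :
    ∃ χ' : α → ℝ, (∀ x ∈ A, |χ' x| = 1) ∧ (∀ x ∉ A, χ' x = χ x) ∧
      ∀ F ∈ 𝓕, |∑ x ∈ F, χ' x - ∑ x ∈ F, χ x| ≤ 2 * t := by
  induction A using Finset.strongInduction generalizing χ with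
  | H A ih =>
  obtain rfl | hA := A.eq_empty_or_nonempty
  · exact ⟨χ, by simp, by simp, by simp⟩
  obtain ⟨y, hy0, hya, hyF⟩ := exists_ne_zero_forall_sum_eq_zero {F ∈ 𝓕 | t < #(F ∩ A)} A
    (card_filter_lt_card_inter_lt 𝓕 t A hA hdeg)
  obtain ⟨s, hs, a, ha, hsa⟩ := exists_add_mul_abs_eq_one A χ y hχ hya
  obtain ⟨χ', h1, h2, h3⟩ := ih (A.erase a) (erase_ssubset ha)
    (fun x hx => hdeg x (mem_of_mem_erase hx)) (fun x => χ x + s * y x)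
    (fun x hx => hs x (mem_of_mem_erase hx))
  have habs : ∀ x ∈ A, |χ' x| = 1 := fun x hx => by
    obtain rfl | hxa := eq_or_ne x a
    · rw [h2 x (notMem_erase x A), hsa]
    · exact h1 x (mem_erase.2 ⟨hxa, hx⟩)
  have hoff : ∀ x ∉ A, χ' x = χ x := fun x hx => by
    rw [h2 x fun h => hx (mem_of_mem_erase h), hy0 x hx, mul_zero, add_zero]
  refine ⟨χ', habs, hoff, fun F hF => ?_⟩
  by_cases hFt : t < #(F ∩ A)
  · have := h3 F hF
    rwa [sum_add_distrib, ← mul_sum, hyF F (mem_filter.2 ⟨hF, hFt⟩), mul_zero, add_zero] at this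
  · have hsum : ∑ x ∈ F, χ' x - ∑ x ∈ F, χ x = ∑ x ∈ F ∩ A, (χ' x - χ x) := by
      rw [← sum_sub_distrib]
      refine (sum_subset inter_subset_left fun x hx hxA => ?_).symm
      rw [hoff x fun h => hxA (mem_inter.2 ⟨hx, h⟩), sub_self]
    rw [hsum]
    calc |∑ x ∈ F ∩ A, (χ' x - χ x)| ≤ ∑ x ∈ F ∩ A, |χ' x - χ x| := abs_sum_le_sum_abs _ _
      _ ≤ ∑ x ∈ F ∩ A, (2 : ℝ) := sum_le_sum fun x hx => by
          have hxA := (mem_inter.1 hx).2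
          linarith [abs_sub (χ' x) (χ x), habs x hxA, hχ x hxA]
      _ = 2 * #(F ∩ A) := by rw [sum_const, nsmul_eq_mul, mul_comm]
      _ ≤ 2 * t := by
          gcongr
          exact not_lt.1 hFt

/-- Dyadic decomposition of the initial segment `[0, u)`, one block for each binary digit `1`
of `u`. -/
theorem ite_lt_eq_sum_dyadic (m u r : ℕ) (hu : u < 2 ^ m) :
    (if r < u then 1 else 0 : ℝ) = ∑ k : Fin m,
      (if u / 2 ^ k.1 % 2 = 1 then 1 else 0) * (if r / 2 ^ k.1 = u / 2 ^ k.1 - 1 then 1 else 0) := by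
  induction m generalizing u r with
  | zero =>
    obtain rfl : u = 0 := by simpa using hu
    simp
  | succ m ih =>
    have h := ih (u / 2) (r / 2) (by rw [pow_succ] at hu; omega)
    simp only [Nat.div_div_eq_div_mul, ← pow_succ'] at h
    rw [Fin.sum_univ_succ]
    simp only [Fin.val_succ, ← h, Fin.val_zero, pow_zero, Nat.div_one]
    split_ifs <;> first | omega | norm_num

open Finset in
/-- Some coloring has discrepancy at most `2 * m ^ d` on every dyadic box of levels below `m`,
where the point `x` has the natural coordinates `r i x`. -/
theorem exists_coloring_dyadic {α : Type*} (X : Finset α) (d m : ℕ) (r : Fin d → α → ℕ) :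
    ∃ χ : α → ℝ, (∀ x ∈ X, |χ x| = 1) ∧ ∀ (k : Fin d → Fin m) (j : Fin d → ℕ),
      |∑ x ∈ X with ∀ i, r i x / 2 ^ (k i).1 = j i, χ x| ≤ 2 * (m : ℝ) ^ d := by
  let box : (Fin d → Fin m) → (Fin d → ℕ) → Finset α := fun k j =>
    {x ∈ X | ∀ i, r i x / 2 ^ (k i).1 = j i}
  let idx : (Fin d → Fin m) → α → Fin d → ℕ := fun k x i => r i x / 2 ^ (k i).1
  let 𝓕 : Finset (Finset α) := (univ ×ˢ X).image fun p => box p.1 (idx p.1 p.2)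
  have hmem : ∀ k j x, x ∈ box k j → j = idx k x := fun k j x hx =>
    funext fun i => ((mem_filter.1 hx).2 i).symm
  have hdeg : ∀ x ∈ X, #{F ∈ 𝓕 | x ∈ F} ≤ m ^ d := fun x _ => by
    have hsub : {F ∈ 𝓕 | x ∈ F} ⊆ univ.image fun k => box k (idx k x) := fun F hF => by
      obtain ⟨hF, hxF⟩ := mem_filter.1 hF
      obtain ⟨p, -, rfl⟩ := mem_image.1 hF
      exact mem_image.2 ⟨p.1, mem_univ _, by rw [hmem _ _ _ hxF]⟩
    exact (card_le_card hsub).trans (card_image_le.trans (by simp))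
  obtain ⟨χ, h1, -, h3⟩ := exists_rounding_of_degree_le 𝓕 (m ^ d) X hdeg 0 (by simp)
  refine ⟨χ, h1, fun k j => ?_⟩
  change |∑ x ∈ box k j, χ x| ≤ _
  obtain he | ⟨x, hx⟩ := (box k j).eq_empty_or_nonempty
  · rw [he, sum_empty, abs_zero]
    positivity
  · have hF : box k j ∈ 𝓕 :=
      mem_image.2 ⟨(k, x), by simp [(mem_filter.1 hx).1], by rw [hmem k j x hx]⟩
    simpa using h3 _ hF

open Finset in
/-- A coloring with small discrepancy on dyadic boxes has small discrepancy on all boxes. -/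
theorem abs_sum_box_le_of_dyadic {α : Type*} (X : Finset α) (d m : ℕ) (r : Fin d → α → ℕ)
    (χ : α → ℝ) (D : ℝ)
    (hD : ∀ (k : Fin d → Fin m) (j : Fin d → ℕ),
      |∑ x ∈ X with ∀ i, r i x / 2 ^ (k i).1 = j i, χ x| ≤ D)
    (l u : Fin d → ℕ) (hlu : l ≤ u) (hu : ∀ i, u i < 2 ^ m) :
    |∑ x ∈ X with ∀ i, l i ≤ r i x ∧ r i x < u i, χ x| ≤ (m * 2 : ℝ) ^ d * D := by
  let w : Fin d → Bool → ℕ := fun i b => if b then u i else l i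
  let c : Fin d → Fin m × Bool → ℝ := fun i q =>
    (if q.2 then 1 else -1) * (if w i q.2 / 2 ^ q.1.1 % 2 = 1 then 1 else 0)
  let j : Fin d → Fin m × Bool → ℕ := fun i q => w i q.2 / 2 ^ q.1.1 - 1
  have hc : ∀ i q, |c i q| ≤ 1 := fun i q => by
    simp only [c]
    split_ifs <;> norm_num
  have hind : ∀ i x, (if l i ≤ r i x ∧ r i x < u i then 1 else 0 : ℝ) =
      ∑ q : Fin m × Bool, c i q * (if r i x / 2 ^ q.1.1 = j i q then 1 else 0) := fun i x => by
    have hsplit : (if l i ≤ r i x ∧ r i x < u i then 1 else 0 : ℝ) =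
        (if r i x < u i then 1 else 0) - (if r i x < l i then 1 else 0) := by
      have : l i ≤ u i := hlu i
      split_ifs <;> first | omega | norm_num
    rw [hsplit, ite_lt_eq_sum_dyadic m _ _ (hu i),
      ite_lt_eq_sum_dyadic m _ _ ((hlu i).trans_lt (hu i)), Fintype.sum_prod_type,
      ← sum_sub_distrib]
    refine sum_congr rfl fun k _ => ?_
    simp only [Fintype.sum_bool, c, j, w, if_true, Bool.false_eq_true, if_false]
    ring
  have hexp : ∑ x ∈ X with ∀ i, l i ≤ r i x ∧ r i x < u i, χ x =
      ∑ p : Fin d → Fin m × Bool, (∏ i, c i (p i)) *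
        ∑ x ∈ X with ∀ i, r i x / 2 ^ (p i).1.1 = j i (p i), χ x := by
    simp only [sum_filter, mul_sum]
    rw [sum_comm]
    refine sum_congr rfl fun x _ => ?_
    calc (if ∀ i, l i ≤ r i x ∧ r i x < u i then χ x else 0)
        = (∏ i, (if l i ≤ r i x ∧ r i x < u i then 1 else 0 : ℝ)) * χ x := by
          simp [prod_ite_zero]
      _ = _ := by
          simp only [hind, prod_univ_sum, Fintype.piFinset_univ, prod_mul_distrib, sum_mul,
            mul_assoc]
          refine sum_congr rfl fun p _ => ?_
          simp [prod_ite_zero]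
  rw [hexp]
  calc _ ≤ ∑ p : Fin d → Fin m × Bool, |(∏ i, c i (p i)) *
        ∑ x ∈ X with ∀ i, r i x / 2 ^ (p i).1.1 = j i (p i), χ x| := abs_sum_le_sum_abs _ _
    _ ≤ ∑ p : Fin d → Fin m × Bool, D := sum_le_sum fun p _ => by
        rw [abs_mul, abs_prod]
        refine (mul_le_of_le_one_left (abs_nonneg _) ?_).trans (hD (fun i => (p i).1) _)
        exact prod_le_one (fun _ _ => abs_nonneg _) fun i _ => hc i _
    _ = (m * 2 : ℝ) ^ d * D := by simp

open Finset in
/-- On a finite set, membership in a box can be read off from the ranks of the coordinates. -/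
theorem mem_Icc_iff_rank {d : ℕ} (X : Finset (Fin d → ℝ)) (a b x : Fin d → ℝ) (hx : x ∈ X) :
    x ∈ Set.Icc a b ↔ ∀ i, #{y ∈ X | y i < a i} ≤ #{y ∈ X | y i < x i} ∧
      #{y ∈ X | y i < x i} < #{y ∈ X | y i ≤ b i} := by
  rw [Set.mem_Icc, Pi.le_def, Pi.le_def, ← forall_and]
  refine forall_congr' fun i => and_congr ⟨fun h => ?_, fun h => ?_⟩ ⟨fun h => ?_, fun h => ?_⟩
  · exact card_le_card fun y hy => by
      rw [mem_filter] at hy ⊢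
      exact ⟨hy.1, hy.2.trans_le h⟩
  · by_contra! hlt
    refine h.not_gt (card_lt_card ((ssubset_iff_of_subset fun y hy => ?_).2 ⟨x, ?_, ?_⟩))
    · rw [mem_filter] at hy ⊢
      exact ⟨hy.1, hy.2.trans hlt⟩
    · exact mem_filter.2 ⟨hx, hlt⟩
    · simp
  · refine card_lt_card ((ssubset_iff_of_subset fun y hy => ?_).2 ⟨x, ?_, ?_⟩)
    · rw [mem_filter] at hy ⊢
      exact ⟨hy.1, hy.2.le.trans h⟩
    · exact mem_filter.2 ⟨hx, h⟩
    · simp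
  · by_contra! hlt
    refine h.not_ge (card_le_card fun y hy => ?_)
    rw [mem_filter] at hy ⊢
    exact ⟨hy.1, hy.2.trans_lt hlt⟩

theorem natLog_two_add_one_le (n : ℕ) (hn : 2 ≤ n) :
    ((Nat.log 2 n + 1 : ℕ) : ℝ) ≤ 2 / Real.log 2 * Real.log n := by
  have h2 : 0 < Real.log 2 := Real.log_pos one_lt_two
  have h1 : (1 : ℝ) ≤ Nat.log 2 n := by exact_mod_cast Nat.log_pos one_lt_two hn
  have hle : (Nat.log 2 n : ℝ) * Real.log 2 ≤ Real.log n := by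
    rw [← Real.log_pow]
    exact Real.log_le_log (by positivity) (by exact_mod_cast Nat.pow_log_le_self 2 (by omega))
  rw [div_mul_eq_mul_div, le_div_iff₀ h2]
  push_cast
  nlinarith



/-- For every dimension `d ≥ 1` there is a constant `C` such that for every
finite set `X ⊂ ℝ^d` with `|X| = n ≥ 2` there exists a coloring `χ : X → {−1, +1}` such
that for every axis-parallel box `R ∈ R_d`, `|∑_{x ∈ X ∩ R} χ(x)| ≤ C (log n)^(2d)`. -/
theorem combinatorial_discrepancy_of_boxes (d : ℕ) (hd : 1 ≤ d) :
    ∃ C : ℝ, ∀ X : Finset (Fin d → ℝ), 2 ≤ X.card →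
      ∃ χ : (Fin d → ℝ) → ℝ,
        (∀ x ∈ X, χ x = 1 ∨ χ x = -1) ∧
        (∀ a b : Fin d → ℝ, a ≤ b →
          |∑ x ∈ X.filter (fun x => x ∈ Set.Icc a b), χ x|
            ≤ C * (Real.log X.card) ^ (2 * d)) := by
  refine ⟨2 ^ d * 2 * (2 / Real.log 2) ^ (2 * d), fun X hX => ?_⟩
  set m := Nat.log 2 X.card + 1
  obtain ⟨χ, h1, hD⟩ := exists_coloring_dyadic X d m fun i x => (X.filter fun y => y i < x i).card
  refine ⟨χ, fun x hx => eq_or_eq_neg_of_abs_eq (h1 x hx), fun a b hab => ?_⟩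
  rw [Finset.filter_congr fun x hx => mem_Icc_iff_rank X a b x hx]
  refine (abs_sum_box_le_of_dyadic X d m _ χ _ hD _ _ (fun i => ?_) fun i => ?_).trans ?_
  · refine Finset.card_le_card fun y hy => ?_
    rw [Finset.mem_filter] at hy ⊢
    exact ⟨hy.1, hy.2.le.trans (hab i)⟩
  · exact (Finset.card_filter_le _ _).trans_lt (Nat.lt_pow_succ_log_self one_lt_two _)
  · calc (m * 2 : ℝ) ^ d * (2 * (m : ℝ) ^ d) = 2 ^ d * 2 * (m : ℝ) ^ (2 * d) := by ring
      _ ≤ 2 ^ d * 2 * (2 / Real.log 2 * Real.log X.card) ^ (2 * d) := by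
          gcongr
          exact natLog_two_add_one_le X.card hX
      _ = _ := by ring
end

section
/- Let μ be a measure on a measurable space, let D be a measurable set with 0 < μ(D) < ∞, let 0 < ε ≤ 1, and let P ⊆ D be a measurable set with μ(D \ P) ≤ (ε/2)·μ(D). Then for every measurable set R, | μ(R∩P)/μ(P) − μ(R∩D)/μ(D) | ≤ ε. -/
open MeasureTheory

/-- if `P ⊆ D` captures all but an `ε/2` fraction of the measure of `D`,
then the normalized measures of `P` and `D` agree on every measurable `R` up to `ε`. -/
theorem eps_approx_of_truncated_domain {Ω : Type*} [MeasurableSpace Ω] (μ : Measure Ω)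
    (D P : Set Ω) (hDm : MeasurableSet D) (hPm : MeasurableSet P) (hPD : P ⊆ D)
    (hD0 : 0 < μ D) (hDfin : μ D < ⊤)
    (ε : ℝ) (hε0 : 0 < ε) (hε1 : ε ≤ 1)
    (hclose : μ (D \ P) ≤ ENNReal.ofReal (ε / 2) * μ D) :
    ∀ R : Set Ω, MeasurableSet R →
      |(μ (R ∩ P)).toReal / (μ P).toReal - (μ (R ∩ D)).toReal / (μ D).toReal| ≤ ε := by
  intro R _
  have hDne : μ D ≠ ⊤ := hDfin.ne
  have hd : 0 < μ.real D := ENNReal.toReal_pos hD0.ne' hDne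
  have hq : μ.real (D \ P) ≤ ε / 2 * μ.real D := by
    have h := ENNReal.toReal_mono (ENNReal.mul_ne_top ENNReal.ofReal_ne_top hDne) hclose
    rwa [ENNReal.toReal_mul, ENNReal.toReal_ofReal (by positivity)] at h
  have hD : μ.real P + μ.real (D \ P) = μ.real D := by
    have h := measureReal_inter_add_sdiff (s := D) hPm hDne
    rwa [Set.inter_eq_right.2 hPD] at h
  have hR : μ.real (R ∩ P) + μ.real ((R ∩ D) \ P) = μ.real (R ∩ D) := by
    have h := measureReal_inter_add_sdiff (s := R ∩ D) hPm
      (measure_ne_top_of_subset Set.inter_subset_right hDne)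
    rwa [Set.inter_assoc, Set.inter_eq_right.2 hPD] at h
  have ha : μ.real (R ∩ P) ≤ μ.real P :=
    measureReal_mono Set.inter_subset_right (measure_ne_top_of_subset hPD hDne)
  have hs : μ.real ((R ∩ D) \ P) ≤ μ.real (D \ P) :=
    measureReal_mono (Set.sdiff_subset_sdiff_left Set.inter_subset_right)
      (measure_ne_top_of_subset Set.sdiff_subset hDne)
  have hp : 0 < μ.real P := by nlinarith
  change |μ.real (R ∩ P) / μ.real P - μ.real (R ∩ D) / μ.real D| ≤ ε
  have ha0 : 0 ≤ μ.real (R ∩ P) := measureReal_nonneg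
  have hs0 : 0 ≤ μ.real ((R ∩ D) \ P) := measureReal_nonneg
  have hqε : μ.real (D \ P) ≤ ε * μ.real D := by nlinarith
  have hpq := mul_le_mul_of_nonneg_left hqε hp.le
  rw [div_sub_div _ _ hp.ne' hd.ne', abs_le, le_div_iff₀ (by positivity),
    div_le_iff₀ (by positivity)]
  constructor
  · have := mul_nonneg ha0 (hs0.trans hs)
    linear_combination this + hpq + mul_le_mul_of_nonneg_left hs hp.le
      + μ.real (R ∩ P) * hD - μ.real P * hR
  · have := mul_nonneg hp.le hs0
    linear_combination this + hpq + mul_le_mul_of_nonneg_right ha (hs0.trans hs)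
      - μ.real (R ∩ P) * hD + μ.real P * hR
end

section
/- There are absolute constants C and c such that the following holds. Let w, l > 0 and let h(x, y) = αx + βy + γ be an affine function that is strictly positive on the rectangle B = [0, w] × [0, l]. Then for every ε ∈ (0, 1/2) there exists a nonempty finite set P ⊂ B with |P| ≤ C·(1/ε)·log(1/ε)·(log(2 + log(1/ε)))^c such that for every axis-parallel rectangle R ⊆ B, | |P ∩ R|/|P| − (∫_R h)/(∫_B h) | ≤ ε. -/
open scoped Classical BigOperators
open MeasureTheory

/-- The base-two radical inverse, whose values form the van der Corput sequence. -/
noncomputable def radicalInverse (n : ℕ) : ℝ :=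
  if n = 0 then 0 else ((n % 2 : ℕ) : ℝ) / 2 + radicalInverse (n / 2) / 2
termination_by n
decreasing_by omega

lemma radicalInverse_zero : radicalInverse 0 = 0 := by
  rw [radicalInverse]; simp

lemma radicalInverse_two_mul (k : ℕ) : radicalInverse (2 * k) = radicalInverse k / 2 := by
  rcases Nat.eq_zero_or_pos k with rfl | hk
  · simp [radicalInverse_zero]
  · rw [radicalInverse, if_neg (by omega)]
    simp

lemma radicalInverse_two_mul_add_one (k : ℕ) :
    radicalInverse (2 * k + 1) = 1 / 2 + radicalInverse k / 2 := by
  rw [radicalInverse, if_neg (by omega), show (2 * k + 1) % 2 = 1 by omega,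
    show (2 * k + 1) / 2 = k by omega]
  simp

lemma radicalInverse_mem_Ico (n : ℕ) : radicalInverse n ∈ Set.Ico (0 : ℝ) 1 := by
  induction n using Nat.strong_induction_on with
  | _ n ih =>
    rcases Nat.even_or_odd' n with ⟨k, rfl | rfl⟩
    · rcases Nat.eq_zero_or_pos k with rfl | hk
      · simp [radicalInverse_zero]
      · have := ih k (by omega)
        rw [radicalInverse_two_mul]
        constructor <;> linarith [this.1, this.2]
    · have := ih k (by omega)
      rw [radicalInverse_two_mul_add_one]
      constructor <;> linarith [this.1, this.2]

lemma sum_range_eq_sum_even_add_sum_odd (f : ℕ → ℝ) (m : ℕ) :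
    ∑ j ∈ Finset.range m, f j =
      ∑ k ∈ Finset.range ((m + 1) / 2), f (2 * k) + ∑ k ∈ Finset.range (m / 2), f (2 * k + 1) := by
  induction m with
  | zero => simp
  | succ m ih =>
    rw [Finset.sum_range_succ, ih]
    rcases Nat.even_or_odd' m with ⟨k, rfl | rfl⟩
    · rw [show (2 * k + 1) / 2 = k by omega, show (2 * k + 1 + 1) / 2 = k + 1 by omega,
        show 2 * k / 2 = k by omega, Finset.sum_range_succ]
      ring
    · rw [show (2 * k + 1) / 2 = k by omega, show (2 * k + 1 + 1) / 2 = k + 1 by omega,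
        show (2 * k + 1 + 1 + 1) / 2 = k + 1 by omega,
        Finset.sum_range_succ (fun k => f (2 * k + 1)) k]
      ring

/-- The first `m ≤ 2 ^ k` terms of the van der Corput sequence have discrepancy at most `k + 1`
with respect to initial intervals, open or closed. -/
lemma abs_sum_indicator_radicalInverse_sub_le (k : ℕ) :
    ∀ (m : ℕ) (T : Set ℝ) (t : ℝ), m ≤ 2 ^ k → 0 ≤ t → t ≤ 1 → Set.Iio t ⊆ T → T ⊆ Set.Iic t →
      |∑ j ∈ Finset.range m, T.indicator (1 : ℝ → ℝ) (radicalInverse j) - m * t| ≤ k + 1 := by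
  induction k with
  | zero =>
    intro m T t hm ht0 ht1 _ _
    have hm' : m = 0 ∨ m = 1 := by simp at hm; omega
    rcases hm' with rfl | rfl
    · simp
    · by_cases h : radicalInverse 0 ∈ T
      · simp [h, abs_le]; constructor <;> linarith
      · simp [h, abs_le]; constructor <;> linarith
  | succ k ih =>
    intro m T t hm ht0 ht1 hlo hhi
    rw [sum_range_eq_sum_even_add_sum_odd]
    have hm1 : (m + 1) / 2 ≤ 2 ^ k := by rw [pow_succ] at hm; omega
    have hm2 : m / 2 ≤ 2 ^ k := by rw [pow_succ] at hm; omega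
    have hsum : (((m + 1) / 2 : ℕ) : ℝ) + ((m / 2 : ℕ) : ℝ) = m := by
      norm_cast; omega
    have hle : ((m / 2 : ℕ) : ℝ) ≤ (((m + 1) / 2 : ℕ) : ℝ) := by norm_cast; omega
    have hge : (((m + 1) / 2 : ℕ) : ℝ) ≤ ((m / 2 : ℕ) : ℝ) + 1 := by norm_cast; omega
    set a : ℝ := (((m + 1) / 2 : ℕ) : ℝ) with ha
    set b : ℝ := ((m / 2 : ℕ) : ℝ) with hb
    rcases lt_or_ge t (1 / 2) with h | h
    · have h2 : ∀ j, T.indicator (1 : ℝ → ℝ) (radicalInverse (2 * j + 1)) = 0 := by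
        intro j
        apply Set.indicator_of_notMem
        intro hj
        have := hhi hj
        rw [Set.mem_Iic, radicalInverse_two_mul_add_one] at this
        linarith [(radicalInverse_mem_Ico j).1]
      have h1 := ih ((m + 1) / 2) {x | x / 2 ∈ T} (2 * t) hm1 (by linarith) (by linarith)
        (fun x hx => hlo (by simp only [Set.mem_Iio] at hx ⊢; linarith))
        (fun x hx => by have := hhi hx; simp only [Set.mem_Iic] at this ⊢; linarith)
      have h3 : ∀ j, T.indicator (1 : ℝ → ℝ) (radicalInverse (2 * j)) =
          {x | x / 2 ∈ T}.indicator (1 : ℝ → ℝ) (radicalInverse j) := by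
        intro j; rw [radicalInverse_two_mul]; simp [Set.indicator]
      simp only [h2, h3, Finset.sum_const_zero, add_zero]
      rw [abs_le] at h1 ⊢
      push_cast
      rw [← hsum]
      constructor <;> nlinarith [h1.1, h1.2]
    · have h2 : ∀ j, T.indicator (1 : ℝ → ℝ) (radicalInverse (2 * j)) = 1 := by
        intro j
        apply Set.indicator_of_mem
        apply hlo
        rw [Set.mem_Iio, radicalInverse_two_mul]
        linarith [(radicalInverse_mem_Ico j).2]
      have h1 := ih (m / 2) {x | 1 / 2 + x / 2 ∈ T} (2 * t - 1) hm2 (by linarith) (by linarith)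
        (fun x hx => hlo (by simp only [Set.mem_Iio] at hx ⊢; linarith))
        (fun x hx => by have := hhi hx; simp only [Set.mem_Iic] at this ⊢; linarith)
      have h3 : ∀ j, T.indicator (1 : ℝ → ℝ) (radicalInverse (2 * j + 1)) =
          {x | 1 / 2 + x / 2 ∈ T}.indicator (1 : ℝ → ℝ) (radicalInverse j) := by
        intro j; rw [radicalInverse_two_mul_add_one]; simp [Set.indicator]
      simp only [h2, h3, Finset.sum_const, Finset.card_range, nsmul_eq_mul, mul_one]
      rw [← ha]
      rw [abs_le] at h1 ⊢
      push_cast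
      rw [← hsum]
      constructor <;> nlinarith [h1.1, h1.2]

/-- Discrepancy of the shifted Hammersley point set with respect to corner boxes. -/
lemma abs_sum_indicator_hammersley_sub_le {k n : ℕ} (hn : n ≤ 2 ^ k) {θ : ℝ}
    (hθ : θ ∈ Set.Ioo (0 : ℝ) 1) {S T : Set ℝ} {s t : ℝ} (hs : s ∈ Set.Icc (0 : ℝ) 1)
    (ht : t ∈ Set.Icc (0 : ℝ) 1) (hS : Set.Iio s ⊆ S) (hS' : S ⊆ Set.Iic s)
    (hT : Set.Iio t ⊆ T) (hT' : T ⊆ Set.Iic t) :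
    |∑ j ∈ Finset.range n, S.indicator (1 : ℝ → ℝ) ((j + θ) / n) *
        T.indicator (1 : ℝ → ℝ) (radicalInverse j) - n * (s * t)| ≤ k + 2 := by
  have hns : 0 ≤ n * s := mul_nonneg (Nat.cast_nonneg _) hs.1
  have hnsn : n * s ≤ n := mul_le_of_le_one_right (Nat.cast_nonneg _) hs.2
  have hT0 : ∀ x, 0 ≤ T.indicator (1 : ℝ → ℝ) x := fun x =>
    Set.indicator_nonneg (fun _ _ => zero_le_one) x
  have hfl : ⌊n * s⌋₊ ≤ n := by
    have := (Nat.floor_le hns).trans hnsn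
    exact_mod_cast this
  have hce : ⌈n * s⌉₊ ≤ n := Nat.ceil_le.2 hnsn
  have h1 := abs_sum_indicator_radicalInverse_sub_le k _ T t (hfl.trans hn) ht.1 ht.2 hT hT'
  have h2 := abs_sum_indicator_radicalInverse_sub_le k _ T t (hce.trans hn) ht.1 ht.2 hT hT'
  have hpos : ∀ j ∈ Finset.range n, (0 : ℝ) < n := fun j hj => by
    have := Finset.mem_range.1 hj
    exact_mod_cast (by omega : 0 < n)
  have hlow : ∑ j ∈ Finset.range ⌊n * s⌋₊, T.indicator (1 : ℝ → ℝ) (radicalInverse j) ≤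
      ∑ j ∈ Finset.range n, S.indicator (1 : ℝ → ℝ) ((j + θ) / n) *
        T.indicator (1 : ℝ → ℝ) (radicalInverse j) := by
    refine le_trans (Finset.sum_le_sum fun j hj => ?_)
      (Finset.sum_le_sum_of_subset_of_nonneg (Finset.range_mono hfl) fun j _ _ =>
        mul_nonneg (Set.indicator_nonneg (fun _ _ => zero_le_one) _) (hT0 _))
    have hj' : j + 1 ≤ ⌊n * s⌋₊ := Finset.mem_range.1 hj
    have hj2 : ((j + 1 : ℕ) : ℝ) ≤ n * s := (Nat.le_floor_iff hns).1 hj'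
    push_cast at hj2
    have : ((j : ℝ) + θ) / n ∈ S := hS (by
      rw [Set.mem_Iio, div_lt_iff₀ (hpos j (Finset.range_mono hfl hj))]
      linarith [hθ.2])
    simp [Set.indicator_of_mem this]
  have hupp : ∑ j ∈ Finset.range n, S.indicator (1 : ℝ → ℝ) ((j + θ) / n) *
        T.indicator (1 : ℝ → ℝ) (radicalInverse j) ≤
      ∑ j ∈ Finset.range ⌈n * s⌉₊, T.indicator (1 : ℝ → ℝ) (radicalInverse j) := by
    rw [← Finset.sum_subset (Finset.range_mono hce)]
    · refine Finset.sum_le_sum fun j _ => mul_le_of_le_one_left (hT0 _) ?_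
      exact Set.indicator_le_self' (fun _ _ => zero_le_one) _
    · intro j hj hj'
      have : ((j : ℝ) + θ) / n ∉ S := fun h => by
        have := hS' h
        rw [Set.mem_Iic, div_le_iff₀ (hpos j hj)] at this
        rw [Finset.mem_range, Nat.lt_ceil, not_lt] at hj'
        linarith [hθ.1]
      rw [Set.indicator_of_notMem this, zero_mul]
  have hf1 := Nat.lt_floor_add_one (n * s)
  have hc1 := Nat.ceil_lt_add_one hns
  rw [abs_le] at h1 h2 ⊢
  have := ht.1
  have := ht.2
  constructor <;> nlinarith [h1.1, h2.2]

/-- The distribution function on `[0, 1]` of the density `2 * t` or `2 * (1 - t)`. -/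
noncomputable def linearCDF (b : Bool) (t : ℝ) : ℝ := bif b then t ^ 2 else 2 * t - t ^ 2

/-- The inverse of `linearCDF` on `[0, 1]`. -/
noncomputable def linearQuantile (b : Bool) (u : ℝ) : ℝ :=
  bif b then √u else 1 - √(1 - u)

lemma linearQuantile_mem_Icc (b : Bool) {u : ℝ} (hu : u ∈ Set.Icc (0 : ℝ) 1) :
    linearQuantile b u ∈ Set.Icc (0 : ℝ) 1 := by
  obtain ⟨h0, h1⟩ := hu
  cases b
  · simp only [linearQuantile, cond_false]
    have : √(1 - u) ≤ 1 := Real.sqrt_le_one.2 (by linarith)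
    constructor <;> linarith [Real.sqrt_nonneg (1 - u)]
  · exact ⟨Real.sqrt_nonneg _, Real.sqrt_le_one.2 h1⟩

lemma linearCDF_linearQuantile (b : Bool) {u : ℝ} (hu : u ∈ Set.Icc (0 : ℝ) 1) :
    linearCDF b (linearQuantile b u) = u := by
  obtain ⟨h0, h1⟩ := hu
  cases b
  · simp only [linearQuantile, linearCDF, cond_false]
    linarith [Real.sq_sqrt (show 0 ≤ 1 - u by linarith)]
  · simp only [linearQuantile, linearCDF, cond_true]
    exact Real.sq_sqrt h0

lemma linearCDF_strictMonoOn (b : Bool) : StrictMonoOn (linearCDF b) (Set.Icc 0 1) := by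
  rintro x ⟨hx0, hx1⟩ y ⟨hy0, hy1⟩ hxy
  cases b <;> simp only [linearCDF, cond_true, cond_false] <;> nlinarith

lemma linearCDF_mem_Icc (b : Bool) {t : ℝ} (ht : t ∈ Set.Icc (0 : ℝ) 1) :
    linearCDF b t ∈ Set.Icc (0 : ℝ) 1 := by
  obtain ⟨h0, h1⟩ := ht
  cases b <;> simp only [linearCDF, cond_true, cond_false] <;> constructor <;> nlinarith

lemma linearQuantile_le_iff (b : Bool) {u t : ℝ} (hu : u ∈ Set.Icc (0 : ℝ) 1)
    (ht : t ∈ Set.Icc (0 : ℝ) 1) : linearQuantile b u ≤ t ↔ u ≤ linearCDF b t := by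
  rw [← (linearCDF_strictMonoOn b).le_iff_le (linearQuantile_mem_Icc b hu) ht,
    linearCDF_linearQuantile b hu]

lemma le_linearQuantile_iff (b : Bool) {u t : ℝ} (hu : u ∈ Set.Icc (0 : ℝ) 1)
    (ht : t ∈ Set.Icc (0 : ℝ) 1) : t ≤ linearQuantile b u ↔ linearCDF b t ≤ u := by
  rw [← (linearCDF_strictMonoOn b).le_iff_le ht (linearQuantile_mem_Icc b hu),
    linearCDF_linearQuantile b hu]

/-- The mass of the rectangle `Set.Icc lo hi` under the product probability measure on
`[0, w] × [0, l]` whose marginals have distribution functions `linearCDF`, rescaled. -/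
noncomputable def cornerMass (w l : ℝ) (c : Bool × Bool) (lo hi : ℝ × ℝ) : ℝ :=
  (linearCDF c.1 (hi.1 / w) - linearCDF c.1 (lo.1 / w)) *
    (linearCDF c.2 (hi.2 / l) - linearCDF c.2 (lo.2 / l))

lemma indicator_Icc_eq_sub {a b : ℝ} (hab : a ≤ b) (x : ℝ) :
    (Set.Icc a b).indicator (1 : ℝ → ℝ) x =
      (Set.Iic b).indicator 1 x - (Set.Iio a).indicator 1 x := by
  simp only [Set.indicator_apply, Set.mem_Icc, Set.mem_Iic, Set.mem_Iio, Pi.one_apply]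
  grind

/-- Discrepancy of the shifted Hammersley point set with respect to closed boxes. -/
lemma abs_sum_indicator_Icc_hammersley_sub_le {k n : ℕ} (hn : n ≤ 2 ^ k) {θ : ℝ}
    (hθ : θ ∈ Set.Ioo (0 : ℝ) 1) {a b c d : ℝ} (ha : a ∈ Set.Icc (0 : ℝ) 1)
    (hb : b ∈ Set.Icc (0 : ℝ) 1) (hc : c ∈ Set.Icc (0 : ℝ) 1) (hd : d ∈ Set.Icc (0 : ℝ) 1)
    (hab : a ≤ b) (hcd : c ≤ d) :
    |∑ j ∈ Finset.range n, (Set.Icc a b).indicator (1 : ℝ → ℝ) ((j + θ) / n) *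
        (Set.Icc c d).indicator (1 : ℝ → ℝ) (radicalInverse j) - n * ((b - a) * (d - c))| ≤
      4 * (k + 2) := by
  have h1 := abs_sum_indicator_hammersley_sub_le hn hθ hb hd
    Set.Iio_subset_Iic_self subset_rfl Set.Iio_subset_Iic_self subset_rfl
  have h2 := abs_sum_indicator_hammersley_sub_le hn hθ ha hd
    subset_rfl Set.Iio_subset_Iic_self Set.Iio_subset_Iic_self subset_rfl
  have h3 := abs_sum_indicator_hammersley_sub_le hn hθ hb hc
    Set.Iio_subset_Iic_self subset_rfl subset_rfl Set.Iio_subset_Iic_self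
  have h4 := abs_sum_indicator_hammersley_sub_le hn hθ ha hc
    subset_rfl Set.Iio_subset_Iic_self subset_rfl Set.Iio_subset_Iic_self
  simp only [indicator_Icc_eq_sub hab, indicator_Icc_eq_sub hcd, sub_mul, mul_sub,
    Finset.sum_sub_distrib]
  rw [abs_le] at *
  constructor <;> linarith [h1.1, h1.2, h2.1, h2.2, h3.1, h3.2, h4.1, h4.2]

lemma div_mem_Icc_zero_one {w x : ℝ} (hw : 0 < w) (hx : x ∈ Set.Icc 0 w) :
    x / w ∈ Set.Icc (0 : ℝ) 1 :=
  ⟨div_nonneg hx.1 hw.le, (div_le_one hw).2 hx.2⟩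

lemma mul_linearQuantile_mem_Icc_iff {w : ℝ} (hw : 0 < w) (b : Bool) {u x y : ℝ}
    (hu : u ∈ Set.Icc (0 : ℝ) 1) (hx : x ∈ Set.Icc 0 w) (hy : y ∈ Set.Icc 0 w) :
    w * linearQuantile b u ∈ Set.Icc x y ↔
      u ∈ Set.Icc (linearCDF b (x / w)) (linearCDF b (y / w)) := by
  rw [Set.mem_Icc, Set.mem_Icc, ← le_linearQuantile_iff b hu (div_mem_Icc_zero_one hw hx),
    ← linearQuantile_le_iff b hu (div_mem_Icc_zero_one hw hy), div_le_iff₀' hw, le_div_iff₀' hw]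

/-- A low-discrepancy point set for a product of two linear densities, disjoint from a given
finite set. -/
lemma exists_finset_cornerMass {w l : ℝ} (hw : 0 < w) (hl : 0 < l) (c : Bool × Bool) {k n : ℕ}
    (hn : n ≤ 2 ^ k) (Q : Finset (ℝ × ℝ)) :
    ∃ P : Finset (ℝ × ℝ), P.card = n ∧ Disjoint Q P ∧
      ↑P ⊆ Set.Icc ((0 : ℝ), (0 : ℝ)) (w, l) ∧
      ∀ lo ∈ Set.Icc ((0 : ℝ), (0 : ℝ)) (w, l), ∀ hi ∈ Set.Icc ((0 : ℝ), (0 : ℝ)) (w, l),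
        lo ≤ hi → |((P.filter (· ∈ Set.Icc lo hi)).card : ℝ) - n * cornerMass w l c lo hi| ≤
          4 * (k + 2) := by
  obtain ⟨θ, hθ, hθQ⟩ := (Set.Ioo_infinite (zero_lt_one' ℝ)).exists_notMem_finset
    ((Q ×ˢ Finset.range n).image fun q => n * linearCDF c.1 (q.1.1 / w) - q.2)
  have hu : ∀ j ∈ Finset.range n, ((j : ℝ) + θ) / n ∈ Set.Icc (0 : ℝ) 1 := by
    intro j hj
    have hj' : ((j + 1 : ℕ) : ℝ) ≤ n := by exact_mod_cast Finset.mem_range.1 hj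
    push_cast at hj'
    have hj0 : (0 : ℝ) ≤ j := Nat.cast_nonneg j
    have := hθ.1
    have := hθ.2
    exact ⟨by positivity, div_le_one_of_le₀ (by linarith) (by linarith)⟩
  have hv : ∀ j, radicalInverse j ∈ Set.Icc (0 : ℝ) 1 := fun j =>
    Set.Ico_subset_Icc_self (radicalInverse_mem_Ico j)
  set f : ℕ → ℝ × ℝ := fun j =>
    (w * linearQuantile c.1 ((j + θ) / n), l * linearQuantile c.2 (radicalInverse j)) with hf
  have hcdf : ∀ j ∈ Finset.range n, n * linearCDF c.1 ((f j).1 / w) = j + θ := by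
    intro j hj
    have hn0 : (n : ℝ) ≠ 0 := by
      have := Finset.mem_range.1 hj
      exact_mod_cast (by omega : n ≠ 0)
    simp only [hf]
    rw [mul_div_cancel_left₀ _ hw.ne', linearCDF_linearQuantile _ (hu j hj)]
    field_simp
  have hinj : Set.InjOn f (Finset.range n : Set ℕ) := by
    intro i hi j hj hij
    have h1 := hcdf i hi
    rw [hij, hcdf j hj] at h1
    have : (j : ℝ) = i := by linarith
    exact_mod_cast this.symm
  refine ⟨(Finset.range n).image f, ?_, ?_, ?_, ?_⟩
  · rw [Finset.card_image_of_injOn hinj, Finset.card_range]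
  · rw [Finset.disjoint_right]
    intro p hp hpQ
    obtain ⟨j, hj, rfl⟩ := Finset.mem_image.1 hp
    refine hθQ (Finset.mem_image.2 ⟨(f j, j), Finset.mk_mem_product hpQ hj, ?_⟩)
    simp only [hcdf j hj, add_sub_cancel_left]
  · intro p hp
    obtain ⟨j, hj, rfl⟩ := Finset.mem_image.1 (Finset.mem_coe.1 hp)
    have h1 := linearQuantile_mem_Icc c.1 (hu j hj)
    have h2 := linearQuantile_mem_Icc c.2 (hv j)
    exact ⟨⟨mul_nonneg hw.le h1.1, mul_nonneg hl.le h2.1⟩,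
      ⟨mul_le_of_le_one_right hw.le h1.2, mul_le_of_le_one_right hl.le h2.2⟩⟩
  · intro lo hlo hi hhi hle
    have hlo1 : lo.1 ∈ Set.Icc 0 w := ⟨hlo.1.1, hlo.2.1⟩
    have hlo2 : lo.2 ∈ Set.Icc 0 l := ⟨hlo.1.2, hlo.2.2⟩
    have hhi1 : hi.1 ∈ Set.Icc 0 w := ⟨hhi.1.1, hhi.2.1⟩
    have hhi2 : hi.2 ∈ Set.Icc 0 l := ⟨hhi.1.2, hhi.2.2⟩
    have key := abs_sum_indicator_Icc_hammersley_sub_le hn hθ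
      (linearCDF_mem_Icc c.1 (div_mem_Icc_zero_one hw hlo1))
      (linearCDF_mem_Icc c.1 (div_mem_Icc_zero_one hw hhi1))
      (linearCDF_mem_Icc c.2 (div_mem_Icc_zero_one hl hlo2))
      (linearCDF_mem_Icc c.2 (div_mem_Icc_zero_one hl hhi2))
      ((linearCDF_strictMonoOn c.1).monotoneOn (div_mem_Icc_zero_one hw hlo1)
        (div_mem_Icc_zero_one hw hhi1) (div_le_div_of_nonneg_right hle.1 hw.le))
      ((linearCDF_strictMonoOn c.2).monotoneOn (div_mem_Icc_zero_one hl hlo2)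
        (div_mem_Icc_zero_one hl hhi2) (div_le_div_of_nonneg_right hle.2 hl.le))
    unfold cornerMass
    convert key using 3
    rw [Finset.filter_image, Finset.card_image_of_injOn
      (hinj.mono (Finset.coe_subset.2 (Finset.filter_subset _ _))), Finset.card_filter]
    push_cast
    refine Finset.sum_congr rfl fun j hj => ?_
    have h1 := mul_linearQuantile_mem_Icc_iff hw c.1 (hu j hj) hlo1 hhi1
    have h2 := mul_linearQuantile_mem_Icc_iff hl c.2 (hv j) hlo2 hhi2
    have h3 : f j ∈ Set.Icc lo hi ↔
        ((j : ℝ) + θ) / n ∈ Set.Icc (linearCDF c.1 (lo.1 / w)) (linearCDF c.1 (hi.1 / w)) ∧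
        radicalInverse j ∈ Set.Icc (linearCDF c.2 (lo.2 / l)) (linearCDF c.2 (hi.2 / l)) := by
      rw [← h1, ← h2]
      simp only [hf, Set.mem_Icc, Prod.le_def]
      tauto
    simp only [h3, Set.indicator_apply, Pi.one_apply, ite_mul, one_mul, zero_mul, ite_and]

/-- Superposition of the point sets of `exists_finset_cornerMass`. -/
lemma exists_finset_sum_cornerMass {w l : ℝ} (hw : 0 < w) (hl : 0 < l) {k : ℕ}
    (n : Bool × Bool → ℕ) (hn : ∀ c, n c ≤ 2 ^ k) (s : Finset (Bool × Bool)) :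
    ∃ P : Finset (ℝ × ℝ), P.card = ∑ c ∈ s, n c ∧
      ↑P ⊆ Set.Icc ((0 : ℝ), (0 : ℝ)) (w, l) ∧
      ∀ lo ∈ Set.Icc ((0 : ℝ), (0 : ℝ)) (w, l), ∀ hi ∈ Set.Icc ((0 : ℝ), (0 : ℝ)) (w, l),
        lo ≤ hi → |((P.filter (· ∈ Set.Icc lo hi)).card : ℝ) -
          ∑ c ∈ s, n c * cornerMass w l c lo hi| ≤ s.card * (4 * (k + 2)) := by
  induction s using Finset.induction_on with
  | empty => exact ⟨∅, by simp⟩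
  | insert c s hc ih =>
    obtain ⟨P, hP, hPB, hPd⟩ := ih
    obtain ⟨P', hP', hdisj, hPB', hPd'⟩ := exists_finset_cornerMass hw hl c (hn c) P
    refine ⟨P ∪ P', ?_, ?_, ?_⟩
    · rw [Finset.card_union_of_disjoint hdisj, Finset.sum_insert hc, hP, hP', add_comm]
    · rw [Finset.coe_union]
      exact Set.union_subset hPB hPB'
    · intro lo hlo hi hhi hle
      have h1 := hPd lo hlo hi hhi hle
      have h2 := hPd' lo hlo hi hhi hle
      rw [Finset.filter_union,
        Finset.card_union_of_disjoint (Finset.disjoint_filter_filter hdisj),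
        Finset.sum_insert hc, Finset.card_insert_of_notMem hc]
      push_cast
      rw [abs_le] at *
      constructor <;> linarith [h1.1, h1.2, h2.1, h2.2]

lemma setIntegral_Icc_affine (α β γ : ℝ) {lo hi : ℝ × ℝ} (h : lo ≤ hi) :
    ∫ p in Set.Icc lo hi, (α * p.1 + β * p.2 + γ) =
      (hi.1 - lo.1) * (hi.2 - lo.2) *
        (α * (lo.1 + hi.1) / 2 + β * (lo.2 + hi.2) / 2 + γ) := by
  have hint : IntegrableOn (fun p : ℝ × ℝ => α * p.1 + β * p.2 + γ)
      (Set.Icc lo.1 hi.1 ×ˢ Set.Icc lo.2 hi.2) (volume.prod volume) := by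
    rw [← Measure.volume_eq_prod]
    exact ContinuousOn.integrableOn_compact (isCompact_Icc.prod isCompact_Icc) (by fun_prop)
  have hinner : ∀ x : ℝ, ∫ y in Set.Icc lo.2 hi.2, (α * x + β * y + γ) =
      (hi.2 - lo.2) * (α * x + β * (lo.2 + hi.2) / 2 + γ) := by
    intro x
    rw [integral_Icc_eq_integral_Ioc, ← intervalIntegral.integral_of_le h.2]
    rw [intervalIntegral.integral_add, intervalIntegral.integral_add,
      intervalIntegral.integral_const_mul β]
    · simp; ring
    all_goals exact Continuous.intervalIntegrable (by fun_prop) _ _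
  rw [show Set.Icc lo hi = Set.Icc lo.1 hi.1 ×ˢ Set.Icc lo.2 hi.2 from
    (Set.Icc_prod_Icc _ _ _ _).symm, Measure.volume_eq_prod, setIntegral_prod _ hint]
  simp only [hinner]
  rw [integral_Icc_eq_integral_Ioc, ← intervalIntegral.integral_of_le h.1]
  rw [intervalIntegral.integral_const_mul, intervalIntegral.integral_add,
    intervalIntegral.integral_add, intervalIntegral.integral_const_mul]
  · simp; ring
  all_goals exact Continuous.intervalIntegrable (by fun_prop) _ _

/-- The probability measure with density proportional to a positive affine function is a mixture
of four product measures. -/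
lemma exists_affine_eq_sum_cornerMass {w l α β γ : ℝ} (hw : 0 < w) (hl : 0 < l)
    (h : ∀ p ∈ Set.Icc ((0 : ℝ), (0 : ℝ)) (w, l), 0 < α * p.1 + β * p.2 + γ) :
    ∃ q : Bool × Bool → ℝ, (∀ c, 0 ≤ q c) ∧ ∑ c, q c = 1 ∧
      ∀ lo hi : ℝ × ℝ, lo ≤ hi →
        (∫ p in Set.Icc lo hi, (α * p.1 + β * p.2 + γ)) /
          (∫ p in Set.Icc ((0 : ℝ), (0 : ℝ)) (w, l), (α * p.1 + β * p.2 + γ)) =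
        ∑ c, q c * cornerMass w l c lo hi := by
  have hcorner : ∀ c : Bool × Bool,
      0 < α * (bif c.1 then w else 0) + β * (bif c.2 then l else 0) + γ := by
    rintro ⟨_ | _, _ | _⟩ <;> refine h (_, _) ?_ <;> simp [Prod.le_def, hw.le, hl.le]
  have hmid : 0 < α * w / 2 + β * l / 2 + γ := by
    have h1 := hcorner (true, true)
    have h2 := hcorner (false, false)
    simp only [cond_true, cond_false] at h1 h2
    linarith
  refine ⟨fun c => (α * (bif c.1 then w else 0) + β * (bif c.2 then l else 0) + γ) /
    (4 * (α * w / 2 + β * l / 2 + γ)), fun c => ?_, ?_, fun lo hi hle => ?_⟩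
  · exact div_nonneg (hcorner c).le (by linarith)
  · rw [← Finset.sum_div, div_eq_one_iff_eq (by positivity)]
    simp [Fintype.sum_prod_type]
    ring
  · rw [setIntegral_Icc_affine _ _ _ hle, setIntegral_Icc_affine _ _ _
      (show ((0 : ℝ), (0 : ℝ)) ≤ (w, l) from ⟨hw.le, hl.le⟩)]
    simp only [Fintype.sum_prod_type, Fintype.sum_bool, cornerMass, linearCDF, cond_true,
      cond_false, zero_add, sub_zero, mul_zero]
    generalize hM : α * w / 2 + β * l / 2 + γ = M at *
    have hγ : γ = M - α * w / 2 - β * l / 2 := by linarith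
    subst hγ
    field_simp
    ring

/-- A dyadic size of order `ε⁻¹ * log ε⁻¹` that beats the discrepancy bound. -/
lemma exists_pow_two_bounds {ε : ℝ} (h0 : 0 < ε) (h1 : ε < 1 / 2) :
    ∃ k : ℕ, (16 * k + 40 : ℝ) ≤ ε * 2 ^ k ∧
      (2 : ℝ) ^ k + 4 ≤ 2056 * (1 / ε) * Real.log (1 / ε) := by
  set L := Real.log (1 / ε) with hL
  have hε : 2 ≤ 1 / ε := by rw [le_div_iff₀ h0]; linarith
  have hL2 : Real.log 2 ≤ L := Real.log_le_log (by norm_num) hε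
  have hlog2 := Real.log_two_gt_d9
  have hX : 1 ≤ 1024 * (1 / ε) * L := by nlinarith
  obtain ⟨k, hk1, hk2⟩ := exists_nat_pow_near hX (one_lt_two : (1 : ℝ) < 2)
  refine ⟨k + 1, ?_, ?_⟩
  · have hεk : 1024 * L ≤ ε * 2 ^ (k + 1) := by
      have := mul_le_mul_of_nonneg_left hk2.le h0.le
      calc 1024 * L = ε * (1024 * (1 / ε) * L) := by field_simp
        _ ≤ _ := this
    have hLpos : 0 < L := by linarith
    have hlog : k * Real.log 2 ≤ 10 * Real.log 2 + L + Real.log L := by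
      have := Real.log_le_log (by positivity) hk1
      rw [Real.log_pow, Real.log_mul (by positivity) hLpos.ne',
        Real.log_mul (by norm_num) (by positivity), ← hL,
        show (1024 : ℝ) = 2 ^ 10 by norm_num, Real.log_pow] at this
      exact_mod_cast this
    have hLL := Real.log_le_sub_one_of_pos hLpos
    have hk0 : (0 : ℝ) ≤ k := Nat.cast_nonneg k
    have : (k : ℝ) * 0.69 ≤ 12 * L := by nlinarith
    push_cast
    linarith
  · have hge : 1 ≤ (1 / ε) * L := by nlinarith
    rw [pow_succ]
    linarith

/-- an ε-approximation of size `O((1/ε) log(1/ε) polyloglog(1/ε))` for a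
rectangle domain `B = [0,w] × [0,l]` weighted by a positive affine function
`h(x,y) = αx + βy + γ`, with respect to axis-parallel rectangles. -/
theorem eps_approx_of_affine_rectangle :
    ∃ C : ℝ, ∃ c : ℕ, ∀ w l α β γ : ℝ, 0 < w → 0 < l →
      (∀ p ∈ Set.Icc ((0 : ℝ), (0 : ℝ)) (w, l), 0 < α * p.1 + β * p.2 + γ) →
      ∀ ε : ℝ, 0 < ε → ε < 1 / 2 →
        ∃ P : Finset (ℝ × ℝ), P.Nonempty ∧
          ↑P ⊆ Set.Icc ((0 : ℝ), (0 : ℝ)) (w, l) ∧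
          (P.card : ℝ) ≤ C * (1 / ε) * Real.log (1 / ε) *
              (Real.log (2 + Real.log (1 / ε))) ^ c ∧
          ∀ lo hi : ℝ × ℝ, lo ≤ hi → Set.Icc lo hi ⊆ Set.Icc ((0 : ℝ), (0 : ℝ)) (w, l) →
            |((P.filter (· ∈ Set.Icc lo hi)).card : ℝ) / P.card -
              (∫ p in Set.Icc lo hi, (α * p.1 + β * p.2 + γ)) /
                (∫ p in Set.Icc ((0 : ℝ), (0 : ℝ)) (w, l), (α * p.1 + β * p.2 + γ))| ≤ ε := by
  refine ⟨2056, 0, fun w l α β γ hw hl h ε hε0 hε1 => ?_⟩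
  obtain ⟨q, hq0, hq1, hq⟩ := exists_affine_eq_sum_cornerMass hw hl h
  obtain ⟨k, hk1, hk2⟩ := exists_pow_two_bounds hε0 hε1
  set N : ℝ := 2 ^ k with hN
  have hNpos : 0 < N := by positivity
  set n : Bool × Bool → ℕ := fun c => ⌈q c * N⌉₊ with hn
  have hqle : ∀ c, q c ≤ 1 := fun c => by
    rw [← hq1]
    exact Finset.single_le_sum (fun c _ => hq0 c) (Finset.mem_univ c)
  have hnle : ∀ c, n c ≤ 2 ^ k := fun c => Nat.ceil_le.2 (by
    push_cast
    exact mul_le_of_le_one_left hNpos.le (hqle c))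
  have hge : ∀ c, q c * N ≤ n c := fun c => Nat.le_ceil _
  have hlt : ∀ c, (n c : ℝ) ≤ q c * N + 1 := fun c =>
    (Nat.ceil_lt_add_one (mul_nonneg (hq0 c) hNpos.le)).le
  obtain ⟨P, hP, hPB, hPd⟩ := exists_finset_sum_cornerMass hw hl n hnle Finset.univ
  have hPge : N ≤ P.card := by
    rw [hP]
    push_cast
    calc N = ∑ c, q c * N := by rw [← Finset.sum_mul, hq1, one_mul]
      _ ≤ _ := Finset.sum_le_sum fun c _ => hge c
  have hPle : (P.card : ℝ) ≤ N + 4 := by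
    rw [hP]
    push_cast
    calc _ ≤ ∑ c, (q c * N + 1) := Finset.sum_le_sum fun c _ => hlt c
      _ = N + 4 := by rw [Finset.sum_add_distrib, ← Finset.sum_mul, hq1]; simp
  have hPpos : (0 : ℝ) < P.card := hNpos.trans_le hPge
  refine ⟨P, Finset.card_pos.1 (by exact_mod_cast hPpos), hPB, ?_, fun lo hi hle hsub => ?_⟩
  · rw [pow_zero, mul_one]
    exact hPle.trans hk2
  · have hlo := hsub (Set.left_mem_Icc.2 hle)
    have hhi := hsub (Set.right_mem_Icc.2 hle)
    have hd := hPd lo hlo hi hhi hle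
    rw [hq lo hi hle]
    have hmass : ∀ c, cornerMass w l c lo hi ∈ Set.Icc (0 : ℝ) 1 := fun c => by
      have a1 := div_mem_Icc_zero_one hw ⟨hlo.1.1, hlo.2.1⟩
      have a2 := div_mem_Icc_zero_one hl ⟨hlo.1.2, hlo.2.2⟩
      have b1 := div_mem_Icc_zero_one hw ⟨hhi.1.1, hhi.2.1⟩
      have b2 := div_mem_Icc_zero_one hl ⟨hhi.1.2, hhi.2.2⟩
      have m1 := (linearCDF_strictMonoOn c.1).monotoneOn a1 b1
        (div_le_div_of_nonneg_right hle.1 hw.le)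
      have m2 := (linearCDF_strictMonoOn c.2).monotoneOn a2 b2
        (div_le_div_of_nonneg_right hle.2 hl.le)
      have a1' := (linearCDF_mem_Icc c.1 a1).1
      have a2' := (linearCDF_mem_Icc c.2 a2).1
      have b1' := (linearCDF_mem_Icc c.1 b1).2
      have b2' := (linearCDF_mem_Icc c.2 b2).2
      exact ⟨mul_nonneg (by linarith) (by linarith),
        mul_le_one₀ (by linarith) (by linarith) (by linarith)⟩
    set μ : ℝ := ∑ c, q c * cornerMass w l c lo hi with hμ
    have hμ0 : 0 ≤ μ := Finset.sum_nonneg fun c _ => mul_nonneg (hq0 c) (hmass c).1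
    have hμ1 : μ ≤ 1 := by
      rw [← hq1]
      exact Finset.sum_le_sum fun c _ => mul_le_of_le_one_right (hq0 c) (hmass c).2
    have hsum1 : N * μ ≤ ∑ c, n c * cornerMass w l c lo hi := by
      rw [hμ, Finset.mul_sum]
      refine Finset.sum_le_sum fun c _ => ?_
      nlinarith [hge c, (hmass c).1]
    have hsum2 : ∑ c, n c * cornerMass w l c lo hi ≤ N * μ + 4 := by
      calc _ ≤ ∑ c, (N * (q c * cornerMass w l c lo hi) + 1) := by
            refine Finset.sum_le_sum fun c _ => ?_
            nlinarith [hlt c, (hmass c).1, (hmass c).2]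
        _ = _ := by rw [Finset.sum_add_distrib, ← Finset.mul_sum, ← hμ]; simp
    have hcard : ((Finset.univ : Finset (Bool × Bool)).card : ℝ) = 4 := by simp
    rw [hcard] at hd
    rw [div_sub' hPpos.ne', abs_div, abs_of_pos hPpos, div_le_iff₀ hPpos]
    have hεP : ε * N ≤ ε * P.card := mul_le_mul_of_nonneg_left hPge hε0.le
    rw [abs_le] at hd ⊢
    constructor <;> nlinarith [hd.1, hd.2]
end
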